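/- arXiv:2303.12713 — 2 statements merged into one kernel-verified Lean document; each statement's English description precedes it below -/
import Mathlib

section
/- Let m ≥ 2 and let M be an m × n m-Hadamardesque matrix with Column Representation Vector v ∈ ℝ^{2^{m-1}}. Then the rows of M are pairwise orthogonal if and only if v lies in the linear span of RC_m, the set of rows of the Sylvester Hadamard matrix H_{2^{m-1}} that are not rows of CT_m. -/
open Matrix
open scoped Classical

/-- `pidx i j` is the 0-indexed position of the pair `(i,j)`, `i < j`, in the standard
ordering `(0,1),(0,2),(1,2),(0,3),...`; it corresponds to the 1-indexed position
`(j-1)(j-2)/2 + i` of the paper (for 1-indexed pairs `1 ≤ i < j ≤ m`). -/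
def pidx (i j : ℕ) : ℕ := j * (j - 1) / 2 + i

lemma pidx_lt {i j m : ℕ} (hij : i < j) (hjm : j < m) : pidx i j < m * (m - 1) / 2 := by
  have h1 : pidx i j < j * (j - 1) / 2 + j := by unfold pidx; omega
  have h2 : j * (j - 1) / 2 + j = (j + 1) * j / 2 := by
    obtain ⟨j', rfl⟩ : ∃ j', j = j' + 1 := ⟨j - 1, by omega⟩
    have h : (j' + 2) * (j' + 1) = (j' + 1) * j' + (j' + 1) * 2 := by ring
    simp only [Nat.add_sub_cancel]
    rw [show j' + 1 + 1 = j' + 2 from rfl, h,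
      Nat.add_mul_div_right _ _ (by norm_num : 0 < 2)]
  have h3 : (j + 1) * j ≤ m * (m - 1) := Nat.mul_le_mul (by omega) (by omega)
  have h4 := Nat.div_le_div_right (c := 2) h3
  omega

/-- `T_m`: the `m × 2^(m-1)` matrix whose columns are exactly the `2^(m-1)` vectors of
the form `(1, ±1, …, ±1)`: `T_m(0,j) = 1` and `T_m(i,j) = (-1)^(bit_(i-1)(j))` for
`i ≥ 1`. -/
def Tmat (m : ℕ) : Matrix (Fin m) (Fin (2 ^ (m - 1))) ℝ :=
  fun i j => if i.val = 0 then 1 else if Nat.testBit j.val (i.val - 1) then -1 else 1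

/-- The Sylvester Hadamard matrix `H_{2^k}`, via `H(i,j) = (-1)^popcount(i AND j)`
(the sum of the binary digits of `i &&& j` is its popcount). -/
def Hsyl (k : ℕ) : Matrix (Fin (2 ^ k)) (Fin (2 ^ k)) ℝ :=
  fun i j => (-1) ^ ((Nat.digits 2 (i.val &&& j.val)).sum)

/-- `CT_m`: the `(m(m-1)/2) × 2^(m-1)` matrix whose `k`-th column is the Column
Pairwise Product of the `k`-th column of `T_m`: its entry in the row at position
`pidx i j` (for the unique pair `i < j` with that position) and column `k` is
`T_m i k * T_m j k`. -/
def CTmat (m : ℕ) : Matrix (Fin (m * (m - 1) / 2)) (Fin (2 ^ (m - 1))) ℝ :=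
  fun p k => ∑ i : Fin m, ∑ j : Fin m,
    if i < j ∧ pidx i.val j.val = p.val then Tmat m i k * Tmat m j k else 0

/-- An `m × n` real matrix is `m`-Hadamardesque if every column is a positive multiple
of some column of `T_m`. -/
def IsHadamardesque {m n : ℕ} (M : Matrix (Fin m) (Fin n) ℝ) : Prop :=
  ∀ k : Fin n, ∃ (p : ℝ) (c : Fin (2 ^ (m - 1))), 0 < p ∧ ∀ i, M i k = p * Tmat m i c

/-- The Column Representation Vector of an (`m`-Hadamardesque) matrix `M`: its `c`-th
coordinate is the sum of `p²` over all columns of `M` equal to `p` times the `c`-th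
column of `T_m` with `p > 0` (for such a column, `p` is its first entry, since the
first entry of each column of `T_m` is `1`), and `0` if no column of `M` is a positive
multiple of the `c`-th column of `T_m`. -/
noncomputable def CRV {m n : ℕ} (hm : 0 < m) (M : Matrix (Fin m) (Fin n) ℝ) :
    Fin (2 ^ (m - 1)) → ℝ :=
  fun c => ∑ k : Fin n,
    if 0 < M ⟨0, hm⟩ k ∧ ∀ i, M i k = M ⟨0, hm⟩ k * Tmat m i c then (M ⟨0, hm⟩ k) ^ 2
    else 0

/-- `RC_m`: the set of rows of `H_{2^(m-1)}` that are not rows of `CT_m`. -/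
def RCset (m : ℕ) : Set (Fin (2 ^ (m - 1)) → ℝ) :=
  {w | (∃ a : Fin (2 ^ (m - 1)), w = Hsyl (m - 1) a) ∧
       ¬∃ p : Fin (m * (m - 1) / 2), w = CTmat m p}

/-- The sign of the popcount of `n < 2 ^ k`, as a product over the `k` bits of `n`. -/
lemma neg_one_pow_digits_sum (k n : ℕ) (hn : n < 2 ^ k) :
    (-1 : ℝ) ^ (Nat.digits 2 n).sum =
      ∏ t ∈ Finset.range k, if n.testBit t then -1 else 1 := by
  induction k generalizing n with
  | zero =>
    obtain rfl : n = 0 := by simpa using hn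
    simp
  | succ k ih =>
    have hdigits : (Nat.digits 2 n).sum = n % 2 + (Nat.digits 2 (n / 2)).sum := by
      rcases Nat.eq_zero_or_pos n with rfl | hpos
      · simp
      · rw [Nat.digits_def' (by norm_num) hpos, List.sum_cons]
    rw [hdigits, pow_add, ih (n / 2) (by rw [pow_succ] at hn; omega),
      Finset.prod_range_succ', mul_comm]
    congr 1
    · simp only [Nat.testBit_succ]
    · rcases Nat.mod_two_eq_zero_or_one n with h | h <;> simp [h]

lemma Hsyl_apply (k : ℕ) (a c : Fin (2 ^ k)) :
    Hsyl k a c =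
      ∏ t ∈ Finset.range k, if a.val.testBit t && c.val.testBit t then -1 else 1 := by
  rw [Hsyl, neg_one_pow_digits_sum k _ (Nat.and_lt_two_pow _ c.isLt)]
  simp only [Nat.testBit_and]

lemma Hsyl_comm (k : ℕ) (a c : Fin (2 ^ k)) : Hsyl k a c = Hsyl k c a := by
  simp only [Hsyl, Nat.land_comm]

lemma Hsyl_mul_self (k : ℕ) (a c : Fin (2 ^ k)) : Hsyl k a c * Hsyl k a c = 1 := by
  rw [Hsyl, ← pow_add, ← two_mul, pow_mul]
  simp

lemma Hsyl_xor (k : ℕ) (a b c : Fin (2 ^ k)) :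
    Hsyl k ⟨a.val ^^^ b.val, Nat.xor_lt_two_pow a.isLt b.isLt⟩ c =
      Hsyl k a c * Hsyl k b c := by
  simp only [Hsyl_apply, ← Finset.prod_mul_distrib, Nat.testBit_xor]
  refine Finset.prod_congr rfl fun t _ => ?_
  cases a.val.testBit t <;> cases b.val.testBit t <;> cases c.val.testBit t <;> norm_num

lemma Hsyl_two_pow (k t : ℕ) (ht : t < k) (c : Fin (2 ^ k)) :
    Hsyl k ⟨2 ^ t, Nat.pow_lt_pow_right (by norm_num) ht⟩ c =
      if c.val.testBit t then -1 else 1 := by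
  rw [Hsyl_apply, Finset.prod_eq_single t]
  · simp
  · intro s _ hst
    simp [Ne.symm hst]
  · simp [ht]

/-- Distinct rows of the Sylvester matrix are orthogonal. -/
lemma Hsyl_dotProduct_of_ne (k : ℕ) {a b : Fin (2 ^ k)} (hab : a ≠ b) :
    Hsyl k a ⬝ᵥ Hsyl k b = 0 := by
  obtain ⟨t, ht⟩ : ∃ t, a.val.testBit t ≠ b.val.testBit t := by
    by_contra! h
    exact hab (Fin.ext (Nat.eq_of_testBit_eq h))
  have htk : t < k := by
    by_contra! hkt
    have hpow : 2 ^ k ≤ 2 ^ t := Nat.pow_le_pow_right (by norm_num) hkt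
    exact ht (by rw [Nat.testBit_lt_two_pow (a.isLt.trans_le hpow),
      Nat.testBit_lt_two_pow (b.isLt.trans_le hpow)])
  let e : Fin (2 ^ k) := ⟨2 ^ t, Nat.pow_lt_pow_right (by norm_num) htk⟩
  let flip : Fin (2 ^ k) → Fin (2 ^ k) := fun c =>
    ⟨c.val ^^^ e.val, Nat.xor_lt_two_pow c.isLt e.isLt⟩
  have hflip (x c : Fin (2 ^ k)) :
      Hsyl k x (flip c) = Hsyl k x c * if x.val.testBit t then -1 else 1 := by
    rw [Hsyl_comm, Hsyl_xor, Hsyl_two_pow k t htk, Hsyl_comm]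
  have hneg (c : Fin (2 ^ k)) :
      Hsyl k a c * Hsyl k b c + Hsyl k a (flip c) * Hsyl k b (flip c) = 0 := by
    rw [hflip, hflip]
    revert ht
    cases a.val.testBit t <;> cases b.val.testBit t <;> simp
  have hinv : Function.Involutive flip := fun c => by
    ext
    simp [flip]
  have hsum : ∑ c, Hsyl k a (flip c) * Hsyl k b (flip c) = ∑ c, Hsyl k a c * Hsyl k b c :=
    Equiv.sum_comp hinv.toPerm fun c => Hsyl k a c * Hsyl k b c
  have htotal := Finset.sum_eq_zero fun c (_ : c ∈ Finset.univ) => hneg c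
  rw [Finset.sum_add_distrib, hsum] at htotal
  rw [dotProduct]
  linarith

lemma Hsyl_dotProduct_self (k : ℕ) (a : Fin (2 ^ k)) : Hsyl k a ⬝ᵥ Hsyl k a = 2 ^ k := by
  simp [dotProduct, Hsyl_mul_self]

/-- Expansion of a vector in the orthogonal basis of Sylvester rows. -/
lemma eq_sum_smul_Hsyl (k : ℕ) (v : Fin (2 ^ k) → ℝ) :
    v = ∑ a, ((v ⬝ᵥ Hsyl k a) / 2 ^ k) • Hsyl k a := by
  ext c
  have hcol (d : Fin (2 ^ k)) :
      ∑ a, Hsyl k a d * Hsyl k a c = if d = c then 2 ^ k else 0 := by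
    simp only [Hsyl_comm k _ d, Hsyl_comm k _ c]
    split_ifs with h
    · subst h
      exact Hsyl_dotProduct_self k d
    · exact Hsyl_dotProduct_of_ne k h
  symm
  calc (∑ a, ((v ⬝ᵥ Hsyl k a) / 2 ^ k) • Hsyl k a) c
      = ∑ a, ∑ d, v d / 2 ^ k * (Hsyl k a d * Hsyl k a c) := by
        simp only [Finset.sum_apply, Pi.smul_apply, smul_eq_mul, dotProduct, Finset.sum_div,
          Finset.sum_mul]
        exact Finset.sum_congr rfl fun _ _ => Finset.sum_congr rfl fun _ _ => by ring
    _ = ∑ d, v d / 2 ^ k * ∑ a, Hsyl k a d * Hsyl k a c := by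
        rw [Finset.sum_comm]
        simp only [Finset.mul_sum]
    _ = v c := by simp [hcol]

lemma exists_Hsyl_eq_Tmat (m : ℕ) (i : Fin m) :
    ∃ a, ∀ c, Hsyl (m - 1) a c = Tmat m i c := by
  by_cases hi : i.val = 0
  · exact ⟨⟨0, by positivity⟩, fun c => by simp [Hsyl, Tmat, hi]⟩
  · refine ⟨_, fun c => (Hsyl_two_pow (m - 1) (i.val - 1) (by omega) c).trans ?_⟩
    rw [Tmat, if_neg hi]

lemma exists_Hsyl_eq_Tmat_mul (m : ℕ) (i j : Fin m) :
    ∃ a, Hsyl (m - 1) a = fun c => Tmat m i c * Tmat m j c := by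
  obtain ⟨a, ha⟩ := exists_Hsyl_eq_Tmat m i
  obtain ⟨b, hb⟩ := exists_Hsyl_eq_Tmat m j
  exact ⟨_, funext fun c => (Hsyl_xor _ a b c).trans (by rw [ha, hb])⟩

lemma pidx_lt_pidx {i j i' j' : ℕ} (hij : i < j) (hjj' : j < j') : pidx i j < pidx i' j' :=
  (pidx_lt hij hjj').trans_le (Nat.le_add_right _ _)

lemma pidx_inj {i j i' j' : ℕ} (hij : i < j) (hij' : i' < j')
    (h : pidx i j = pidx i' j') : i = i' ∧ j = j' := by
  rcases lt_trichotomy j j' with hlt | rfl | hlt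
  · exact absurd h (pidx_lt_pidx hij hlt).ne
  · simpa [pidx] using h
  · exact absurd h (pidx_lt_pidx hij' hlt).ne'

lemma CTmat_pidx (m : ℕ) {i j : Fin m} (hij : i < j) :
    CTmat m ⟨pidx i j, pidx_lt hij j.isLt⟩ = fun c => Tmat m i c * Tmat m j c := by
  ext c
  have hiff (i' j' : Fin m) :
      (i' < j' ∧ pidx i'.val j'.val = pidx i.val j.val) ↔ i' = i ∧ j' = j := by
    constructor
    · rintro ⟨hlt, h⟩
      obtain ⟨h₁, h₂⟩ := pidx_inj hlt hij h
      exact ⟨Fin.ext h₁, Fin.ext h₂⟩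
    · rintro ⟨rfl, rfl⟩
      exact ⟨hij, rfl⟩
  simp only [CTmat, hiff, ite_and]
  simp

lemma dotProduct_CTmat (m : ℕ) (v : Fin (2 ^ (m - 1)) → ℝ) (p : Fin (m * (m - 1) / 2)) :
    v ⬝ᵥ CTmat m p = ∑ i : Fin m, ∑ j : Fin m,
      if i < j ∧ pidx i.val j.val = p.val then v ⬝ᵥ fun c => Tmat m i c * Tmat m j c
      else 0 := by
  simp only [dotProduct, CTmat, Finset.mul_sum]
  rw [Finset.sum_comm]
  refine Finset.sum_congr rfl fun i _ => ?_
  rw [Finset.sum_comm]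
  refine Finset.sum_congr rfl fun j _ => ?_
  split_ifs <;> simp

/-- The columns of `T_m` are pairwise distinct. -/
lemma Tmat_col_injective (m : ℕ) {c d : Fin (2 ^ (m - 1))}
    (h : ∀ i, Tmat m i c = Tmat m i d) : c = d := by
  refine Fin.ext (Nat.eq_of_testBit_eq fun t => ?_)
  by_cases ht : t < m - 1
  · have hbit := h ⟨t + 1, by omega⟩
    simp only [Tmat, Nat.add_eq_zero_iff, one_ne_zero, and_false, if_false,
      Nat.add_sub_cancel] at hbit
    revert hbit
    cases c.val.testBit t <;> cases d.val.testBit t <;> norm_num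
  · have hpow : 2 ^ (m - 1) ≤ 2 ^ t := Nat.pow_le_pow_right (by norm_num) (by omega)
    rw [Nat.testBit_lt_two_pow (c.isLt.trans_le hpow),
      Nat.testBit_lt_two_pow (d.isLt.trans_le hpow)]

/-- Inner products of rows of `M` in terms of the Column Representation Vector. -/
lemma CRV_dotProduct_Tmat_mul {m n : ℕ} (hm : 0 < m) (M : Matrix (Fin m) (Fin n) ℝ)
    (hM : IsHadamardesque M) (i j : Fin m) :
    (CRV hm M ⬝ᵥ fun c => Tmat m i c * Tmat m j c) = M i ⬝ᵥ M j := by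
  simp only [dotProduct, CRV, Finset.sum_mul]
  rw [Finset.sum_comm]
  refine Finset.sum_congr rfl fun k _ => ?_
  obtain ⟨p, c, hp, hcol⟩ := hM k
  have hfirst : M ⟨0, hm⟩ k = p := by simp [hcol, Tmat]
  rw [hfirst, Finset.sum_eq_single c]
  · rw [if_pos ⟨hp, hcol⟩, hcol i, hcol j]
    ring
  · intro d _ hdc
    rw [if_neg, zero_mul]
    rintro ⟨-, hd⟩
    refine hdc (Tmat_col_injective m fun l => mul_left_cancel₀ hp.ne' ?_)
    rw [← hd l, hcol l]
  · simp

/-- A vector lies in the span of `RC_m` iff it is orthogonal to every product of two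
distinct rows of `T_m`. -/
lemma mem_span_RCset_iff (m : ℕ) (v : Fin (2 ^ (m - 1)) → ℝ) :
    v ∈ Submodule.span ℝ (RCset m) ↔
      ∀ i j : Fin m, i < j → (v ⬝ᵥ fun c => Tmat m i c * Tmat m j c) = 0 := by
  constructor
  · intro hv i j hij
    obtain ⟨b, hb⟩ := exists_Hsyl_eq_Tmat_mul m i j
    rw [← hb]
    induction hv using Submodule.span_induction with
    | mem w hw =>
      obtain ⟨⟨a, rfl⟩, hnot⟩ := hw
      refine Hsyl_dotProduct_of_ne _ ?_
      rintro rfl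
      exact hnot ⟨_, hb.trans (CTmat_pidx m hij).symm⟩
    | zero => exact zero_dotProduct _
    | add x y _ _ hx hy => rw [add_dotProduct, hx, hy, add_zero]
    | smul r x _ hx => rw [smul_dotProduct, hx, smul_zero]
  · intro h
    rw [eq_sum_smul_Hsyl (m - 1) v]
    refine Submodule.sum_mem _ fun a _ => ?_
    by_cases ha : ∃ p, Hsyl (m - 1) a = CTmat m p
    · obtain ⟨p, hp⟩ := ha
      have hzero : v ⬝ᵥ Hsyl (m - 1) a = 0 := by
        rw [hp, dotProduct_CTmat]
        refine Finset.sum_eq_zero fun i _ => Finset.sum_eq_zero fun j _ => ?_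
        split_ifs with hij
        · exact h i j hij.1
        · rfl
      simp [hzero]
    · exact Submodule.smul_mem _ _ (Submodule.subset_span ⟨⟨a, rfl⟩, ha⟩)

/-- For `m ≥ 2` and an `m`-Hadamardesque matrix `M` with Column Representation Vector
`v`: the rows of `M` are pairwise orthogonal iff `v` lies in the linear span of
`RC_m`, the set of rows of `H_(2^(m-1))` that are not rows of `CT_m`. -/
theorem rows_orthogonal_iff_crv_mem_span_RC (m n : ℕ) (hm : 2 ≤ m)
    (M : Matrix (Fin m) (Fin n) ℝ) (hM : IsHadamardesque M) :
    (∀ i j : Fin m, i ≠ j → M i ⬝ᵥ M j = 0) ↔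
      CRV (by omega : 0 < m) M ∈ Submodule.span ℝ (RCset m) := by
  rw [mem_span_RCset_iff]
  simp only [CRV_dotProduct_Tmat_mul _ M hM]
  constructor
  · exact fun h i j hij => h i j hij.ne
  · intro h i j hij
    rcases hij.lt_or_gt with hlt | hlt
    · exact h i j hlt
    · rw [dotProduct_comm]
      exact h j i hlt
end

section
/- Let m ≥ 2. For every vector a ∈ ℚ^{m(m-1)/2} there exist n ∈ ℕ, a positive irrational real number r, and an m × n matrix M all of whose entries belong to {r, -r}, whose first row is constantly r (so M is m-Hadamardesque), such that for all 1 ≤ i < j ≤ m, the dot product of the i-th and j-th rows of M equals the coordinate of a at position (j-1)(j-2)/2 + i. -/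
open Matrix
open scoped Classical

/-- A function on sign vectors that changes sign when coordinate `p` is flipped sums to zero. -/
lemma sum_eq_zero_of_flip {m : ℕ} (p : Fin m) (f : (Fin m → ℤˣ) → ℤ)
    (hf : ∀ x, f (Pi.mulSingle p (-1) * x) = -f x) : ∑ x, f x = 0 := by
  have h := Equiv.sum_comp (Equiv.mulLeft (Pi.mulSingle p (-1) : Fin m → ℤˣ)) f
  simp only [Equiv.coe_mulLeft, hf, Finset.sum_neg_distrib] at h
  omega

/-- Products of two distinct coordinates are orthogonal functions on sign vectors. -/
lemma sum_sign_products {m : ℕ} {i j k l : Fin m} (hij : i < j) (hkl : k < l) :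
    ∑ x : Fin m → ℤˣ, ((x k : ℤ) * x l) * ((x i : ℤ) * x j) =
      if k = i ∧ l = j then 2 ^ m else 0 := by
  split_ifs with h
  · obtain ⟨rfl, rfl⟩ := h
    have hsq : ∀ x : Fin m → ℤˣ, ((x k : ℤ) * x l) * ((x k : ℤ) * x l) = 1 := fun x => by
      rw [← Units.val_mul, ← Units.val_mul, Int.units_mul_self, Units.val_one]
    simp [hsq]
  · by_cases hi : i = k ∨ i = l
    · have hjk : j ≠ k := by grind
      have hjl : j ≠ l := by grind
      refine sum_eq_zero_of_flip j _ fun x => ?_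
      simp [Pi.mulSingle_eq_of_ne hjk.symm, Pi.mulSingle_eq_of_ne hjl.symm,
        Pi.mulSingle_eq_of_ne hij.ne]
    · rw [not_or] at hi
      refine sum_eq_zero_of_flip i _ fun x => ?_
      simp [Pi.mulSingle_eq_of_ne (Ne.symm hi.1), Pi.mulSingle_eq_of_ne (Ne.symm hi.2),
        Pi.mulSingle_eq_of_ne hij.ne.symm]

/-- Distinct coordinates are orthogonal functions on sign vectors. -/
lemma sum_sign_pair {m : ℕ} {i j : Fin m} (hij : i < j) :
    ∑ x : Fin m → ℤˣ, (x i : ℤ) * x j = 0 := by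
  refine sum_eq_zero_of_flip i _ fun x => ?_
  simp [Pi.mulSingle_eq_of_ne hij.ne.symm]

/-- Every integer family `2 ^ m * b i j`, `i < j`, is the family of pair correlations of some
natural number weight on the sign vectors of length `m`. -/
lemma exists_weight_sign_correlations {m : ℕ} (b : Fin m → Fin m → ℤ) :
    ∃ w : (Fin m → ℤˣ) → ℕ, ∀ i j, i < j →
      ∑ x, (w x : ℤ) * ((x i : ℤ) * x j) = 2 ^ m * b i j := by
  let B : Fin m → Fin m → ℤ := fun k l => if k < l then b k l else 0
  let N : ℤ := ∑ k, ∑ l, |B k l|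
  let W : (Fin m → ℤˣ) → ℤ := fun x => N + ∑ k, ∑ l, B k l * ((x k : ℤ) * x l)
  have hW : ∀ x, 0 ≤ W x := fun x => by
    simp only [W, N, ← Finset.sum_add_distrib]
    refine Finset.sum_nonneg fun k _ => Finset.sum_nonneg fun l _ => ?_
    rw [← Units.val_mul]
    rcases Int.units_eq_one_or (x k * x l) with h | h <;> rw [h] <;> simp
    · linarith [neg_abs_le (B k l)]
    · linarith [le_abs_self (B k l)]
  refine ⟨fun x => (W x).toNat, fun i j hij => ?_⟩
  simp only [Int.toNat_of_nonneg (hW _)]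
  have hpair : ∀ k l, ∑ x : Fin m → ℤˣ, B k l * ((x k : ℤ) * x l) * ((x i : ℤ) * x j) =
      if k = i ∧ l = j then 2 ^ m * b i j else 0 := fun k l => by
    by_cases hkl : k < l
    · simp only [mul_assoc (B k l), ← Finset.mul_sum, sum_sign_products hij hkl]
      split_ifs with h
      · obtain ⟨rfl, rfl⟩ := h
        simp [B, hkl, mul_comm]
      · simp
    · have : ¬(k = i ∧ l = j) := by rintro ⟨rfl, rfl⟩; exact hkl hij
      simp [B, hkl, this]
  simp only [W, add_mul, Finset.sum_add_distrib, ← Finset.mul_sum, sum_sign_pair hij,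
    Finset.sum_mul]
  rw [Finset.sum_comm]
  simp only [Finset.sum_comm (s := (Finset.univ : Finset (Fin m → ℤˣ))), hpair]
  simp [ite_and]

/-- Every sign vector with first entry `1` is a column of `Tmat m`. -/
lemma exists_Tmat_column {m : ℕ} (hm : 0 < m) (y : Fin m → ℤˣ) (hy : y ⟨0, hm⟩ = 1) :
    ∃ c, ∀ i, ((y i : ℤ) : ℝ) = Tmat m i c := by
  let f : Fin (m - 1) → Bool := fun t => decide (y ⟨t + 1, by omega⟩ = -1)
  refine ⟨⟨Nat.ofBits f, Nat.ofBits_lt_two_pow f⟩, fun i => ?_⟩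
  by_cases hi : i.val = 0
  · have : i = ⟨0, hm⟩ := Fin.ext hi
    simp [Tmat, this, hy]
  · have hlt : i.val - 1 < m - 1 := by omega
    have hi' : (⟨i.val - 1 + 1, by omega⟩ : Fin m) = i := Fin.ext (by simp; omega)
    simp only [Tmat, hi, if_false, Nat.testBit_ofBits_lt f _ hlt, f, hi']
    rcases Int.units_eq_one_or (y i) with h | h <;> simp [h]

/-- A finite family of rationals has a positive common denominator. -/
lemma exists_common_denominator {ι : Type*} [Fintype ι] (a : ι → ℚ) :
    ∃ D : ℕ, 0 < D ∧ ∃ z : ι → ℤ, ∀ t, a t * D = z t := by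
  refine ⟨∏ t, (a t).den, Finset.prod_pos fun t _ => (a t).den_pos, ?_⟩
  choose e he using fun t => Finset.dvd_prod_of_mem (fun t => (a t).den) (Finset.mem_univ t)
  refine ⟨fun t => (a t).num * e t, fun t => ?_⟩
  rw [he t]
  push_cast
  rw [← mul_assoc, Rat.mul_den_eq_num]

/-- For `m ≥ 2` and every `a ∈ ℚ^(m(m-1)/2)`, there are `n ∈ ℕ`, a positive
irrational real `r`, and an `m × n` matrix `M` all of whose entries are `±r` and
whose first row is constantly `r` (so `M` is `m`-Hadamardesque), whose pairwise row
dot products realize `a`. -/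
theorem exists_irrational_hadamardesque_with_prescribed_rowdots (m : ℕ) (hm : 2 ≤ m)
    (a : Fin (m * (m - 1) / 2) → ℚ) :
    ∃ (n : ℕ) (r : ℝ) (M : Matrix (Fin m) (Fin n) ℝ),
      0 < r ∧ Irrational r ∧
      (∀ i k, M i k = r ∨ M i k = -r) ∧
      (∀ k, M ⟨0, by omega⟩ k = r) ∧
      IsHadamardesque M ∧
      ∀ (i j : Fin m) (h : i < j),
        M i ⬝ᵥ M j = ((a ⟨pidx i j, pidx_lt h j.isLt⟩ : ℚ) : ℝ) := by
  obtain ⟨D, hD, z, hz⟩ := exists_common_denominator a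
  obtain ⟨w, hw⟩ := exists_weight_sign_correlations (m := m) fun i j =>
    if h : i < j then 2 * D * 2 ^ m * z ⟨pidx i j, pidx_lt h j.isLt⟩ else 0
  let K : ℕ := D * 2 ^ m
  have hK : K ≠ 0 := by positivity
  let r : ℝ := (√2 * K)⁻¹
  have hr : 0 < r := by positivity
  let o : Fin m := ⟨0, by omega⟩
  let e := Fintype.equivFin (Σ x : Fin m → ℤˣ, Fin (w x))
  let y : Fin (Fintype.card (Σ x : Fin m → ℤˣ, Fin (w x))) → Fin m → ℤˣ :=
    fun k i => (e.symm k).1 o * (e.symm k).1 i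
  have hy : ∀ k, y k o = 1 := fun k => Int.units_mul_self _
  refine ⟨_, r, fun i k => r * ((y k i : ℤ) : ℝ), hr, ?_, fun i k => ?_, fun k => ?_,
    fun k => ?_, fun i j h => ?_⟩
  · exact (irrational_sqrt_two.mul_natCast hK).inv
  · rcases Int.units_eq_one_or (y k i) with h | h <;> simp [h]
  · change r * ((y k o : ℤ) : ℝ) = r
    simp [hy]
  · obtain ⟨c, hc⟩ := exists_Tmat_column (by omega) (y k) (hy k)
    exact ⟨r, c, hr, fun i => congrArg (r * ·) (hc i)⟩
  · have hyy : ∀ k, (y k i : ℤ) * y k j = ((e.symm k).1 i : ℤ) * (e.symm k).1 j := fun k => by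
      rw [← Units.val_mul, ← Units.val_mul, mul_mul_mul_comm, Int.units_mul_self, one_mul]
    have hsum : ∑ k, (y k i : ℤ) * y k j = 2 ^ m * (2 * D * 2 ^ m *
        z ⟨pidx i j, pidx_lt h j.isLt⟩) := by
      simp only [hyy]
      rw [Equiv.sum_comp e.symm fun s => (s.1 i : ℤ) * s.1 j, Fintype.sum_sigma]
      simpa [h] using hw i j h
    have hdot : (fun k => r * ((y k i : ℤ) : ℝ)) ⬝ᵥ (fun k => r * ((y k j : ℤ) : ℝ)) =
        r ^ 2 * ((∑ k, (y k i : ℤ) * y k j : ℤ) : ℝ) := by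
      simp only [dotProduct]
      push_cast
      rw [Finset.mul_sum]
      exact Finset.sum_congr rfl fun k _ => by ring
    have hzr : ((a ⟨pidx i j, pidx_lt h j.isLt⟩ : ℚ) : ℝ) * D =
        z ⟨pidx i j, pidx_lt h j.isLt⟩ := by exact_mod_cast hz _
    have hr2 : r ^ 2 = (2 * ((D : ℝ) * 2 ^ m) ^ 2)⁻¹ := by
      simp only [r, K, inv_pow, mul_pow, Real.sq_sqrt (zero_le_two (α := ℝ))]
      push_cast
      ring
    refine hdot.trans ?_
    rw [hsum, hr2]
    push_cast
    rw [← hzr]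
    field_simp
end
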